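/- arXiv:math/0609537 — 4 statements merged into one kernel-verified Lean document; each statement's English description precedes it below -/
import Mathlib

section
/- Let R be a commutative ring and f : M → N a morphism in Ch_*(R). The following are equivalent: (1) f induces an isomorphism H_nM → H_nN for all n ≥ 0 and f_n : M_n → N_n is surjective for all n > 0; (2) for every n ≥ 0 the induced map M_n → Z_{n-1}M ×_{Z_{n-1}N} N_n (into the fibre product formed from the map Z_{n-1}M → Z_{n-1}N induced by f and the map N_n → Z_{n-1}N induced by the differential) is surjective. Moreover, under either condition the induced map Z_nM → Z_nN on cycles is surjective for all n ≥ 0. -/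
open CategoryTheory

namespace HomologicalComplex

universe v u

variable {R : Type u} [Ring R] {ι : Type*} {c : ComplexShape ι}

section

variable (K : HomologicalComplex (ModuleCat.{v} R) c)

theorem moduleCat_d_d_apply (i j k : ι) (x : K.X i) : K.d j k (K.d i j x) = 0 := by
  rw [← ConcreteCategory.comp_apply, K.d_comp_d]
  rfl

theorem moduleCat_d_iCycles_apply (i j : ι) (x : K.cycles i) :
    K.d i j (K.iCycles i x) = 0 := by
  rw [← ConcreteCategory.comp_apply, K.iCycles_d]
  rfl

theorem moduleCat_exists_iCycles_eq {i j : ι} (hj : c.next i = j) (z : K.X i)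
    (hz : K.d i j z = 0) : ∃ x : K.cycles i, K.iCycles i x = z := by
  let k : ModuleCat.of R (LinearMap.ker (K.d i j).hom) ⟶ K.X i :=
    ModuleCat.ofHom (LinearMap.ker (K.d i j).hom).subtype
  have hk : k ≫ K.d i j = 0 := by
    ext x
    exact x.2
  refine ⟨K.liftCycles k j hj hk ⟨z, hz⟩, ?_⟩
  rw [← ConcreteCategory.comp_apply, K.liftCycles_i]
  rfl

theorem moduleCat_iCycles_injective (i : ι) : Function.Injective (K.iCycles i) :=
  (ModuleCat.mono_iff_injective _).1 inferInstance

theorem moduleCat_homologyπ_surjective (i : ι) : Function.Surjective (K.homologyπ i) :=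
  (ModuleCat.epi_iff_surjective _).1 inferInstance

theorem moduleCat_homologyπ_eq_zero_iff {i j : ι} (hi : c.prev j = i) (x : K.cycles j) :
    K.homologyπ j x = 0 ↔ ∃ y : K.X i, K.d i j y = K.iCycles j x := by
  have hex : (ShortComplex.mk _ _ (K.toCycles_comp_homologyπ i j)).Exact :=
    ShortComplex.exact_of_g_is_cokernel _ (K.homologyIsCokernel i j hi)
  rw [ShortComplex.ShortExact.moduleCat_exact_iff_function_exact] at hex
  refine (hex x).trans (exists_congr fun y => ?_)
  rw [← (K.moduleCat_iCycles_injective j).eq_iff, ← ConcreteCategory.comp_apply]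
  dsimp only
  rw [K.toCycles_i]

end

variable {K L : HomologicalComplex (ModuleCat.{v} R) c} (φ : K ⟶ L)

theorem moduleCat_f_d_apply (i j : ι) (x : K.X i) :
    φ.f j (K.d i j x) = L.d i j (φ.f i x) := by
  rw [← ConcreteCategory.comp_apply, ← ConcreteCategory.comp_apply, φ.comm]

theorem moduleCat_iCycles_cyclesMap_apply (i : ι) (x : K.cycles i) :
    L.iCycles i (cyclesMap φ i x) = φ.f i (K.iCycles i x) := by
  rw [← ConcreteCategory.comp_apply, ← ConcreteCategory.comp_apply, cyclesMap_i]

theorem moduleCat_homologyMap_homologyπ_apply (i : ι) (x : K.cycles i) :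
    homologyMap φ i (K.homologyπ i x) = L.homologyπ i (cyclesMap φ i x) := by
  rw [← ConcreteCategory.comp_apply, ← ConcreteCategory.comp_apply, homologyπ_naturality]

theorem moduleCat_homologyMap_injective_iff {i j k : ι} (hi : c.prev j = i)
    (hk : c.next j = k) :
    Function.Injective (homologyMap φ j) ↔
      ∀ (z : K.X j) (y : L.X i), K.d j k z = 0 → φ.f j z = L.d i j y →
        ∃ x : K.X i, K.d i j x = z := by
  rw [injective_iff_map_eq_zero]
  constructor
  · intro h z y hz hy
    obtain ⟨x, rfl⟩ := K.moduleCat_exists_iCycles_eq hk z hz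
    refine (K.moduleCat_homologyπ_eq_zero_iff hi x).1 (h _ ?_)
    rw [moduleCat_homologyMap_homologyπ_apply, L.moduleCat_homologyπ_eq_zero_iff hi]
    exact ⟨y, by rw [moduleCat_iCycles_cyclesMap_apply, hy]⟩
  · intro h a ha
    obtain ⟨x, rfl⟩ := K.moduleCat_homologyπ_surjective j a
    rw [moduleCat_homologyMap_homologyπ_apply, L.moduleCat_homologyπ_eq_zero_iff hi] at ha
    obtain ⟨y, hy⟩ := ha
    rw [moduleCat_iCycles_cyclesMap_apply] at hy
    exact (K.moduleCat_homologyπ_eq_zero_iff hi x).2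
      (h _ y (K.moduleCat_d_iCycles_apply j k x) hy.symm)

theorem moduleCat_homologyMap_surjective_iff {i j k : ι} (hi : c.prev j = i)
    (hk : c.next j = k) :
    Function.Surjective (homologyMap φ j) ↔
      ∀ w : L.X j, L.d j k w = 0 →
        ∃ (z : K.X j) (y : L.X i), K.d j k z = 0 ∧ φ.f j z + L.d i j y = w := by
  constructor
  · intro h w hw
    obtain ⟨b, rfl⟩ := L.moduleCat_exists_iCycles_eq hk w hw
    obtain ⟨a, ha⟩ := h (L.homologyπ j b)
    obtain ⟨x, rfl⟩ := K.moduleCat_homologyπ_surjective j a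
    rw [moduleCat_homologyMap_homologyπ_apply, eq_comm, ← sub_eq_zero, ← map_sub,
      L.moduleCat_homologyπ_eq_zero_iff hi] at ha
    obtain ⟨y, hy⟩ := ha
    refine ⟨K.iCycles j x, y, K.moduleCat_d_iCycles_apply j k x, ?_⟩
    rw [hy, map_sub, moduleCat_iCycles_cyclesMap_apply, add_sub_cancel]
  · intro h b
    obtain ⟨w, rfl⟩ := L.moduleCat_homologyπ_surjective j b
    obtain ⟨z, y, hz, hzy⟩ := h _ (L.moduleCat_d_iCycles_apply j k w)
    obtain ⟨x, rfl⟩ := K.moduleCat_exists_iCycles_eq hk z hz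
    refine ⟨K.homologyπ j x, ?_⟩
    rw [moduleCat_homologyMap_homologyπ_apply, eq_comm, ← sub_eq_zero, ← map_sub,
      L.moduleCat_homologyπ_eq_zero_iff hi]
    refine ⟨y, ?_⟩
    rw [map_sub, moduleCat_iCycles_cyclesMap_apply, ← hzy, add_sub_cancel_left]

theorem moduleCat_isIso_homologyMap_iff {i j k : ι} (hi : c.prev j = i)
    (hk : c.next j = k) :
    IsIso (homologyMap φ j) ↔
      (∀ (z : K.X j) (y : L.X i), K.d j k z = 0 → φ.f j z = L.d i j y →
        ∃ x : K.X i, K.d i j x = z) ∧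
      ∀ w : L.X j, L.d j k w = 0 →
        ∃ (z : K.X j) (y : L.X i), K.d j k z = 0 ∧ φ.f j z + L.d i j y = w := by
  rw [← moduleCat_homologyMap_injective_iff φ hi hk,
    ← moduleCat_homologyMap_surjective_iff φ hi hk]
  exact ConcreteCategory.isIso_iff_bijective _

end HomologicalComplex

namespace ChainComplex

open HomologicalComplex

universe v u

variable {R : Type u} [Ring R] {M N : ChainComplex (ModuleCat.{v} R) ℕ} (f : M ⟶ N)

theorem next_nat (n : ℕ) : (ComplexShape.down ℕ).next n = n - 1 := by
  cases n <;> simp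

theorem moduleCat_isIso_homologyMap_iff (n : ℕ) :
    IsIso (homologyMap f n) ↔
      (∀ (z : M.X n) (y : N.X (n + 1)), M.d n (n - 1) z = 0 → f.f n z = N.d (n + 1) n y →
        ∃ x : M.X (n + 1), M.d (n + 1) n x = z) ∧
      ∀ w : N.X n, N.d n (n - 1) w = 0 →
        ∃ (z : M.X n) (y : N.X (n + 1)), M.d n (n - 1) z = 0 ∧
          f.f n z + N.d (n + 1) n y = w :=
  HomologicalComplex.moduleCat_isIso_homologyMap_iff f (ChainComplex.prev ℕ n) (next_nat n)

theorem moduleCat_d_zero_apply (z : M.X 0) : M.d 0 (0 - 1) z = 0 := by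
  rw [M.shape _ _ (by simp)]
  rfl

section

variable (hf : ∀ (n : ℕ) (z : M.X n) (y : N.X (n + 1)),
  M.d n (n - 1) z = 0 → f.f n z = N.d (n + 1) n y →
    ∃ x : M.X (n + 1), M.d (n + 1) n x = z ∧ f.f (n + 1) x = y)

include hf

theorem moduleCat_exists_cycle_of_surjective (h₀ : Function.Surjective (f.f 0)) (n : ℕ)
    (w : N.X n) (hw : N.d n (n - 1) w = 0) :
    ∃ z : M.X n, M.d n (n - 1) z = 0 ∧ f.f n z = w := by
  cases n with
  | zero =>
    obtain ⟨z, rfl⟩ := h₀ w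
    exact ⟨z, moduleCat_d_zero_apply z, rfl⟩
  | succ n =>
    exact hf n 0 w (map_zero _) ((map_zero _).trans hw.symm)

theorem moduleCat_isIso_homologyMap_of_surjective (h₀ : Function.Surjective (f.f 0)) (n : ℕ) :
    IsIso (homologyMap f n) := by
  refine (moduleCat_isIso_homologyMap_iff f n).2 ⟨fun z y hz hy => ?_, fun w hw => ?_⟩
  · obtain ⟨x, hx, -⟩ := hf n z y hz hy
    exact ⟨x, hx⟩
  · obtain ⟨z, hz, hzw⟩ := moduleCat_exists_cycle_of_surjective f hf h₀ n w hw
    exact ⟨z, 0, hz, by rw [map_zero, add_zero, hzw]⟩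

theorem moduleCat_f_succ_surjective_of_surjective (h₀ : Function.Surjective (f.f 0)) (n : ℕ) :
    Function.Surjective (f.f (n + 1)) := by
  intro y
  obtain ⟨z, hz, hzy⟩ := moduleCat_exists_cycle_of_surjective f hf h₀ n (N.d (n + 1) n y)
    (N.moduleCat_d_d_apply _ _ _ y)
  obtain ⟨x, -, hx⟩ := hf n z y hz hzy
  exact ⟨x, hx⟩

end

section

variable (hiso : ∀ n : ℕ, IsIso (homologyMap f n))
  (hsurj : ∀ n : ℕ, 0 < n → Function.Surjective (f.f n))

include hiso hsurj

theorem moduleCat_exists_cycle_of_isIso (n : ℕ) (w : N.X n) (hw : N.d n (n - 1) w = 0) :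
    ∃ z : M.X n, M.d n (n - 1) z = 0 ∧ f.f n z = w := by
  obtain ⟨z, y, hz, hzy⟩ := ((moduleCat_isIso_homologyMap_iff f n).1 (hiso n)).2 w hw
  obtain ⟨x, rfl⟩ := hsurj (n + 1) n.succ_pos y
  refine ⟨z + M.d (n + 1) n x, ?_, ?_⟩
  · rw [map_add, hz, M.moduleCat_d_d_apply, add_zero]
  · rw [map_add, moduleCat_f_d_apply, hzy]

theorem moduleCat_f_zero_surjective_of_isIso : Function.Surjective (f.f 0) := fun w =>
  let ⟨z, _, hz⟩ := moduleCat_exists_cycle_of_isIso f hiso hsurj 0 w (moduleCat_d_zero_apply w)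
  ⟨z, hz⟩

theorem moduleCat_exists_lift_of_isIso (n : ℕ) (z : M.X n) (y : N.X (n + 1))
    (hz : M.d n (n - 1) z = 0) (hy : f.f n z = N.d (n + 1) n y) :
    ∃ x : M.X (n + 1), M.d (n + 1) n x = z ∧ f.f (n + 1) x = y := by
  obtain ⟨x, rfl⟩ := ((moduleCat_isIso_homologyMap_iff f n).1 (hiso n)).1 z y hz hy
  have hw : N.d (n + 1) n (y - f.f (n + 1) x) = 0 := by
    rw [map_sub, ← moduleCat_f_d_apply, hy, sub_self]
  obtain ⟨z', hz', hfz'⟩ := moduleCat_exists_cycle_of_isIso f hiso hsurj (n + 1) _ hw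
  refine ⟨x + z', ?_, ?_⟩
  · rw [map_add, add_eq_left]
    exact hz'
  · rw [map_add, hfz', add_sub_cancel]

end

end ChainComplex

/-- For a morphism `f : M ⟶ N` of non-negatively graded chain complexes of
`R`-modules, the following are equivalent: (1) `f` induces an isomorphism on homology in
every degree and is surjective in positive degrees; (2) for every `n ≥ 0` the induced map
`M_n → Z_{n-1}M ×_{Z_{n-1}N} N_n` is surjective (with the convention `Z_{-1} = 0`, so the
`n = 0` case says `M₀ → N₀` is surjective).  Moreover, under either condition the induced
map on cycles `Z_nM → Z_nN` is surjective for all `n`. -/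
theorem statement0 (R : Type) [CommRing R]
    (M N : ChainComplex (ModuleCat R) ℕ) (f : M ⟶ N) :
    (((∀ n : ℕ, IsIso (HomologicalComplex.homologyMap f n)) ∧
        ∀ n : ℕ, 0 < n → Function.Surjective (f.f n)) ↔
      (Function.Surjective (f.f 0) ∧
        ∀ (n : ℕ) (z : M.X n) (y : N.X (n + 1)),
          M.d n (n - 1) z = 0 → f.f n z = N.d (n + 1) n y →
            ∃ x : M.X (n + 1), M.d (n + 1) n x = z ∧ f.f (n + 1) x = y)) ∧
    ((((∀ n : ℕ, IsIso (HomologicalComplex.homologyMap f n)) ∧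
        ∀ n : ℕ, 0 < n → Function.Surjective (f.f n)) ∨
      (Function.Surjective (f.f 0) ∧
        ∀ (n : ℕ) (z : M.X n) (y : N.X (n + 1)),
          M.d n (n - 1) z = 0 → f.f n z = N.d (n + 1) n y →
            ∃ x : M.X (n + 1), M.d (n + 1) n x = z ∧ f.f (n + 1) x = y)) →
      ∀ (n : ℕ) (w : N.X n), N.d n (n - 1) w = 0 →
        ∃ z : M.X n, M.d n (n - 1) z = 0 ∧ f.f n z = w) := by
  refine ⟨⟨fun ⟨hiso, hsurj⟩ => ?_, fun ⟨h₀, hf⟩ => ?_⟩, ?_⟩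
  · exact ⟨ChainComplex.moduleCat_f_zero_surjective_of_isIso f hiso hsurj,
      ChainComplex.moduleCat_exists_lift_of_isIso f hiso hsurj⟩
  · refine ⟨ChainComplex.moduleCat_isIso_homologyMap_of_surjective f hf h₀, fun n hn => ?_⟩
    obtain ⟨n, rfl⟩ := Nat.exists_eq_succ_of_ne_zero hn.ne'
    exact ChainComplex.moduleCat_f_succ_surjective_of_surjective f hf h₀ n
  · rintro (⟨hiso, hsurj⟩ | ⟨h₀, hf⟩)
    · exact ChainComplex.moduleCat_exists_cycle_of_isIso f hiso hsurj
    · exact ChainComplex.moduleCat_exists_cycle_of_surjective f hf h₀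
end

section
/- Let C be a model category and A an object of C. Suppose f₁ : X₁ → A is a weak equivalence and f₂ : X₂ → A is an acyclic fibration, with both X₁ and X₂ cofibrant. Then there exists a weak equivalence g : X₁ → X₂ with f₂∘g = f₁, and g is unique up to left homotopy over A. Furthermore, if f₁ is also an acyclic fibration, then X₁ and X₂ are homotopy equivalent over A: there are maps g : X₁ → X₂ and h : X₂ → X₁ over A with h∘g left homotopic to the identity of X₁ and g∘h left homotopic to the identity of X₂. -/
open CategoryTheory CategoryTheory.Limits

universe v u

/-- A morphism `f` is a retract of a morphism `g` if there is a commutative diagram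
displaying `f` as a retract of `g` in the arrow category. -/
def IsRetractOfHom {C : Type u} [Category.{v} C] {A B X Y : C}
    (f : A ⟶ B) (g : X ⟶ Y) : Prop :=
  ∃ (i : A ⟶ X) (r : X ⟶ A) (i' : B ⟶ Y) (r' : Y ⟶ B),
    i ≫ r = 𝟙 A ∧ i' ≫ r' = 𝟙 B ∧ i ≫ g = f ≫ i' ∧ g ≫ r' = r ≫ f

/-- The axioms of a model category for three given classes of morphisms (weak equivalences,
fibrations, cofibrations) on a category `C`: `C` is closed under all small limits and
colimits, the three classes are closed under retracts, the weak equivalences satisfy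
two-out-of-three, lifting of cofibrations against fibrations whenever one of the two is a
weak equivalence, and the two factorization axioms. -/
structure IsModelCategory {C : Type u} [Category.{v} C]
    (weq fib cof : MorphismProperty C) : Prop where
  hasLimits : HasLimits C
  hasColimits : HasColimits C
  weq_retract : ∀ {A B X Y : C} (f : A ⟶ B) (g : X ⟶ Y), IsRetractOfHom f g → weq g → weq f
  fib_retract : ∀ {A B X Y : C} (f : A ⟶ B) (g : X ⟶ Y), IsRetractOfHom f g → fib g → fib f
  cof_retract : ∀ {A B X Y : C} (f : A ⟶ B) (g : X ⟶ Y), IsRetractOfHom f g → cof g → cof f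
  weq_comp : ∀ {X Y Z : C} (f : X ⟶ Y) (g : Y ⟶ Z), weq f → weq g → weq (f ≫ g)
  weq_of_comp_left : ∀ {X Y Z : C} (f : X ⟶ Y) (g : Y ⟶ Z), weq f → weq (f ≫ g) → weq g
  weq_of_comp_right : ∀ {X Y Z : C} (f : X ⟶ Y) (g : Y ⟶ Z), weq g → weq (f ≫ g) → weq f
  lift_acyclicCof_fib : ∀ {A B X Y : C} (j : A ⟶ B) (q : X ⟶ Y),
    cof j → weq j → fib q → HasLiftingProperty j q
  lift_cof_acyclicFib : ∀ {A B X Y : C} (j : A ⟶ B) (q : X ⟶ Y),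
    cof j → fib q → weq q → HasLiftingProperty j q
  factor_cof_acyclicFib : ∀ {X Y : C} (f : X ⟶ Y),
    ∃ (Z : C) (i : X ⟶ Z) (p : Z ⟶ Y), cof i ∧ fib p ∧ weq p ∧ i ≫ p = f
  factor_acyclicCof_fib : ∀ {X Y : C} (f : X ⟶ Y),
    ∃ (Z : C) (i : X ⟶ Z) (p : Z ⟶ Y), cof i ∧ weq i ∧ fib p ∧ i ≫ p = f

/-- A model category structure on a category `C`: three classes of morphisms satisfying the
model category axioms. -/
structure ModelStruct (C : Type u) [Category.{v} C] where
  weq : MorphismProperty C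
  fib : MorphismProperty C
  cof : MorphismProperty C
  isModel : IsModelCategory weq fib cof

/-- `f` and `g` are left homotopic over `A` (for maps of objects over `A`): there is a
cylinder object for `B` and a homotopy `H` from `f` to `g` whose composite with the
structure map to `A` is the constant homotopy. -/
def LeftHomotopicOver {C : Type u} [Category.{v} C] [HasColimits C] (S : ModelStruct C)
    {B X A : C} (pB : B ⟶ A) (pX : X ⟶ A) (f g : B ⟶ X) : Prop :=
  ∃ (CB : C) (i₀ i₁ : B ⟶ CB) (p : CB ⟶ B),
    S.cof (coprod.desc i₀ i₁) ∧ S.weq p ∧ i₀ ≫ p = 𝟙 B ∧ i₁ ≫ p = 𝟙 B ∧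
    ∃ H : CB ⟶ X, i₀ ≫ H = f ∧ i₁ ≫ H = g ∧ H ≫ pX = p ≫ pB

/-- Every lift problem from a cofibrant object against an acyclic fibration has a solution. -/
theorem ModelStruct.exists_lift_of_cofibrant {C : Type u} [Category.{v} C] [HasColimits C]
    (S : ModelStruct C) {A B X : C} (pB : B ⟶ A) (pX : X ⟶ A)
    (hB : S.cof (initial.to B)) (hfib : S.fib pX) (hweq : S.weq pX) :
    ∃ g : B ⟶ X, g ≫ pX = pB := by
  have := S.isModel.lift_cof_acyclicFib _ _ hB hfib hweq
  have sq : CommSq (initial.to X) (initial.to B) pX pB := ⟨initial.hom_ext _ _⟩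
  exact ⟨sq.lift, sq.fac_right⟩

/-- Every object has a cylinder object. -/
theorem ModelStruct.exists_cylinder {C : Type u} [Category.{v} C] [HasColimits C]
    (S : ModelStruct C) (B : C) :
    ∃ (CB : C) (i₀ i₁ : B ⟶ CB) (p : CB ⟶ B),
      S.cof (coprod.desc i₀ i₁) ∧ S.weq p ∧ i₀ ≫ p = 𝟙 B ∧ i₁ ≫ p = 𝟙 B := by
  obtain ⟨CB, i, p, hi, -, hp, fac⟩ :=
    S.isModel.factor_cof_acyclicFib (coprod.desc (𝟙 B) (𝟙 B))
  refine ⟨CB, coprod.inl ≫ i, coprod.inr ≫ i, p, ?_, hp, ?_, ?_⟩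
  · have h : coprod.desc (coprod.inl ≫ i) (coprod.inr ≫ i) = i :=
      coprod.hom_ext (coprod.inl_desc _ _) (coprod.inr_desc _ _)
    rwa [h]
  · rw [Category.assoc, fac, coprod.inl_desc]
  · rw [Category.assoc, fac, coprod.inr_desc]

/-- Any two maps over `A` into an acyclic fibration over `A` are left homotopic over `A`. -/
theorem ModelStruct.leftHomotopicOver_of_acyclicFib {C : Type u} [Category.{v} C]
    [HasColimits C] (S : ModelStruct C) {A B X : C} {pB : B ⟶ A} {pX : X ⟶ A}
    (hfib : S.fib pX) (hweq : S.weq pX) {f g : B ⟶ X} (hf : f ≫ pX = pB) (hg : g ≫ pX = pB) :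
    LeftHomotopicOver S pB pX f g := by
  obtain ⟨CB, i₀, i₁, p, hi, hp, h₀, h₁⟩ := S.exists_cylinder B
  have := S.isModel.lift_cof_acyclicFib _ _ hi hfib hweq
  have sq : CommSq (coprod.desc f g) (coprod.desc i₀ i₁) pX (p ≫ pB) :=
    ⟨by ext <;> simp [hf, hg, reassoc_of% h₀, reassoc_of% h₁]⟩
  refine ⟨CB, i₀, i₁, p, hi, hp, h₀, h₁, sq.lift, ?_, ?_, sq.fac_right⟩
  · exact (coprod.inl_desc_assoc i₀ i₁ sq.lift).symm.trans (by rw [sq.fac_left, coprod.inl_desc])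
  · exact (coprod.inr_desc_assoc i₀ i₁ sq.lift).symm.trans (by rw [sq.fac_left, coprod.inr_desc])

/-- uniqueness of cofibrant replacements.  If `f₁ : X₁ → A` is a weak
equivalence and `f₂ : X₂ → A` an acyclic fibration with `X₁`, `X₂` cofibrant, then there is
a weak equivalence `g : X₁ → X₂` over `A`, unique up to left homotopy over `A`; and if `f₁`
is also an acyclic fibration then `X₁` and `X₂` are homotopy equivalent over `A`. -/
theorem statement7 {C : Type u} [Category.{v} C] [HasColimits C]
    (S : ModelStruct C) {A X₁ X₂ : C}
    (f₁ : X₁ ⟶ A) (f₂ : X₂ ⟶ A)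
    (hf₁ : S.weq f₁) (hf₂fib : S.fib f₂) (hf₂weq : S.weq f₂)
    (hX₁ : S.cof (initial.to X₁)) (hX₂ : S.cof (initial.to X₂)) :
    (∃ g : X₁ ⟶ X₂, S.weq g ∧ g ≫ f₂ = f₁) ∧
    (∀ g₁ g₂ : X₁ ⟶ X₂, g₁ ≫ f₂ = f₁ → g₂ ≫ f₂ = f₁ →
      LeftHomotopicOver S f₁ f₂ g₁ g₂) ∧
    (S.fib f₁ → ∃ (g : X₁ ⟶ X₂) (h : X₂ ⟶ X₁),
      g ≫ f₂ = f₁ ∧ h ≫ f₁ = f₂ ∧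
      LeftHomotopicOver S f₁ f₁ (g ≫ h) (𝟙 X₁) ∧
      LeftHomotopicOver S f₂ f₂ (h ≫ g) (𝟙 X₂)) := by
  obtain ⟨g, hg⟩ := S.exists_lift_of_cofibrant f₁ f₂ hX₁ hf₂fib hf₂weq
  refine ⟨⟨g, S.isModel.weq_of_comp_right g f₂ hf₂weq (hg ▸ hf₁), hg⟩,
    fun _ _ h₁ h₂ => S.leftHomotopicOver_of_acyclicFib hf₂fib hf₂weq h₁ h₂, fun hf₁fib => ?_⟩
  obtain ⟨h, hh⟩ := S.exists_lift_of_cofibrant f₂ f₁ hX₂ hf₁fib hf₁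
  exact ⟨g, h, hg, hh,
    S.leftHomotopicOver_of_acyclicFib hf₁fib hf₁ (by simp [hh, hg]) (Category.id_comp _),
    S.leftHomotopicOver_of_acyclicFib hf₂fib hf₂weq (by simp [hh, hg]) (Category.id_comp _)⟩
end

section
/- Let F : C ⇄ D : G be a Quillen functor between model categories C and D. Then the total left derived functor LF and the total right derived functor RG exist and form an adjoint pair LF : Ho(C) ⇄ Ho(D) : RG between the homotopy categories. Furthermore, this adjoint pair is an equivalence of categories if and only if (F, G) is a Quillen equivalence. -/
open CategoryTheory CategoryTheory.Limits

universe v u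

universe v₂ u₂

namespace CategoryTheory

open CategoryTheory.Functor

section

variable {A B : Type*} [Category* A] [Category* B]

lemma Adjunction.isIso_homEquiv_iff {P : A ⥤ B} {R : B ⥤ A} (adj : P ⊣ R)
    [P.IsEquivalence] {X : A} {Y : B} (g : P.obj X ⟶ Y) :
    IsIso (adj.homEquiv X Y g) ↔ IsIso g := by
  have := adj.isEquivalence_right_of_isEquivalence_left
  rw [adj.homEquiv_unit, isIso_comp_left_iff, isIso_iff_of_reflects_iso]

end

section

variable {C₁ C₂ D₂ H : Type*} [Category* C₁] [Category* C₂] [Category* D₂] [Category* H]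
  {W₁ : MorphismProperty C₁} {W₂ : MorphismProperty C₂} (Φ : LocalizerMorphism W₁ W₂)

lemma LocalizerMorphism.natTrans_ext_of_hasLeftResolutions [Φ.HasLeftResolutions]
    (L : C₂ ⥤ D₂) [L.IsLocalization W₂] {K : C₂ ⥤ H} {M : D₂ ⥤ H} {σ τ : L ⋙ M ⟶ K}
    (h : ∀ X, σ.app (Φ.functor.obj X) = τ.app (Φ.functor.obj X)) : σ = τ := by
  ext X
  have R : Φ.LeftResolution X := Classical.arbitrary _
  have := Localization.inverts L W₂ R.w R.hw
  have : IsIso ((L ⋙ M).map R.w) := by dsimp; infer_instance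
  rw [← cancel_epi ((L ⋙ M).map R.w), σ.naturality, τ.naturality, h]

lemma LocalizerMorphism.isLeftDerivedFunctor_of_isIso [Φ.HasLeftResolutions]
    [Φ.IsLocalizedEquivalence] {L : C₂ ⥤ D₂} [L.IsLocalization W₂] {K : C₂ ⥤ H} {LK : D₂ ⥤ H}
    (α : L ⋙ LK ⟶ K) (hα : ∀ X, IsIso (α.app (Φ.functor.obj X))) :
    LK.IsLeftDerivedFunctor α W₂ where
  isRightKanExtension := by
    let αι : Φ.functor ⋙ L ⋙ LK ⟶ Φ.functor ⋙ K := whiskerLeft Φ.functor α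
    have : ∀ X, IsIso (αι.app X) := hα
    have : IsIso αι := NatIso.isIso_of_isIso_app _
    let ff (M N : D₂ ⥤ H) : (M ⟶ N) ≃ ((Φ.functor ⋙ L) ⋙ M ⟶ (Φ.functor ⋙ L) ⋙ N) :=
      (Localization.fullyFaithfulWhiskeringLeft (Φ.functor ⋙ L) W₁ H).homEquiv
    have ff_app {M N : D₂ ⥤ H} (γ : M ⟶ N) (X : C₁) :
        (ff M N γ).app X = γ.app (L.obj (Φ.functor.obj X)) := rfl
    refine ⟨⟨IsTerminal.ofUniqueHom (fun E ↦ CostructuredArrow.homMk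
      ((ff E.left LK).symm (whiskerLeft Φ.functor E.hom ≫ CategoryTheory.inv αι)) ?_) (fun E m ↦ ?_)⟩⟩
    · apply Φ.natTrans_ext_of_hasLeftResolutions L
      intro X
      have h := NatTrans.congr_app ((ff E.left LK).apply_symm_apply
        (whiskerLeft Φ.functor E.hom ≫ CategoryTheory.inv αι)) X
      rw [ff_app] at h
      change ((ff E.left LK).symm _).app _ ≫ αι.app X = _
      rw [h]
      simp
    · apply CostructuredArrow.hom_ext
      refine (Equiv.eq_symm_apply (ff E.left LK)).2 ?_
      rw [IsIso.eq_comp_inv]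
      ext X
      exact NatTrans.congr_app (CostructuredArrow.w m) (Φ.functor.obj X)

lemma LocalizerMorphism.exists_leftDerived_of_derives [Φ.IsLeftDerivabilityStructure]
    (L : C₂ ⥤ D₂) [L.IsLocalization W₂] (K : C₂ ⥤ H) (hK : Φ.Derives K) :
    ∃ (LK : D₂ ⥤ H) (α : L ⋙ LK ⟶ K), ∀ X, IsIso (α.app (Φ.functor.obj X)) := by
  have hK' : Φ.op.Derives K.op := fun _ _ f hf ↦ by
    have := hK f.unop hf
    exact inferInstanceAs (IsIso ((Φ.functor ⋙ K).map f.unop).op)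
  have := hK'.hasPointwiseRightDerivedFunctor
  let RK := K.op.totalRightDerived L.op W₂.op
  let α := K.op.totalRightDerivedUnit L.op W₂.op
  refine ⟨RK.unop,
    { app X := (α.app (.op X)).unop
      naturality X Y f := Quiver.Hom.op_inj (α.naturality f.op).symm }, fun X ↦ ?_⟩
  have : IsIso (α.app (.op (Φ.functor.obj X))) :=
    hK'.isIso_of_isRightDerivedFunctor α (.op X)
  exact inferInstanceAs (IsIso (α.app (.op (Φ.functor.obj X))).unop)

end

end CategoryTheory

namespace HomotopicalAlgebra

section

variable {C H : Type*} [Category* C] [ModelCategory C] [Category* H]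
  (L : C ⥤ H) [L.IsLocalization (weakEquivalences C)]

lemma weakEquivalence_of_fibration_of_isIso_map {X Y : C} (p : X ⟶ Y) [IsCofibrant X]
    [IsFibrant X] [IsCofibrant Y] [Fibration p] [IsIso (L.map p)] [IsFibrant Y] :
    WeakEquivalence p := by
  obtain ⟨g, hg⟩ := map_surjective_of_isLocalization L Y X (inv (L.map p))
  have hgp : LeftHomotopyRel (g ≫ p) (𝟙 Y) := by
    rw [LeftHomotopyRel.iff_map_eq L]
    simp [hg]
  obtain ⟨P, _, ⟨h⟩⟩ := hgp.exists_good_cylinder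
  obtain ⟨s, h', hh'⟩ := h.covering_homotopy p g
  have hs : s ≫ p = 𝟙 Y := by rw [← h'.h₁, Category.assoc, hh', h.h₁]
  have hps : LeftHomotopyRel (𝟙 X) (p ≫ s) := by
    rw [LeftHomotopyRel.iff_map_eq L, ← cancel_mono (L.map p), ← L.map_comp, ← L.map_comp,
      Category.assoc, hs, Category.id_comp, Category.comp_id]
  obtain ⟨Q, ⟨hQ⟩⟩ := hps
  have : WeakEquivalence (p ≫ s) := hQ.weakEquivalence_iff.1 inferInstance
  rw [weakEquivalence_iff]
  refine (weakEquivalences C).of_retract (g := p ≫ s) ?_ (mem_weakEquivalences (p ≫ s))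
  exact
    { i := Arrow.homMk (𝟙 X) s
      r := Arrow.homMk (𝟙 X) p (by simp [hs]) }

/-- Weak equivalences in a model category are saturated. -/
lemma isIso_map_iff_weakEquivalence {X Y : C} (f : X ⟶ Y) :
    IsIso (L.map f) ↔ WeakEquivalence f := by
  have inv {X Y : C} (w : X ⟶ Y) [WeakEquivalence w] : IsIso (L.map w) :=
    Localization.inverts L (weakEquivalences C) w (mem_weakEquivalences w)
  refine ⟨fun _ ↦ ?_, fun _ ↦ inv f⟩
  obtain ⟨X', _, w, _, _⟩ := CofibrantObject.HoCat.exists_resolution X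
  let h₁ := MorphismProperty.factorizationData (cofibrations C) (trivialFibrations C) (w ≫ f)
  have : IsCofibrant h₁.Z := isCofibrant_of_cofibration h₁.i
  let j := FibrantObject.HoCat.iResolutionObj h₁.Z
  have : IsCofibrant (FibrantObject.HoCat.resolutionObj h₁.Z) := isCofibrant_of_cofibration j
  let h₂ := MorphismProperty.factorizationData (trivialCofibrations C) (fibrations C) (h₁.i ≫ j)
  have : IsCofibrant h₂.Z := isCofibrant_of_cofibration h₂.i
  have : IsFibrant h₂.Z := isFibrant_of_fibration h₂.p
  have : IsIso (L.map h₁.i) := by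
    have : IsIso (L.map h₁.i ≫ L.map h₁.p) := by
      rw [← L.map_comp, h₁.fac, L.map_comp]
      have := inv w
      infer_instance
    have := inv h₁.p
    exact IsIso.of_isIso_comp_right _ (L.map h₁.p)
  have : IsIso (L.map h₂.p) := by
    have : IsIso (L.map h₂.i ≫ L.map h₂.p) := by
      rw [← L.map_comp, h₂.fac, L.map_comp]
      have := inv j
      infer_instance
    have := inv h₂.i
    exact IsIso.of_isIso_comp_left (L.map h₂.i) _
  have := weakEquivalence_of_fibration_of_isIso_map L h₂.p
  have : WeakEquivalence (h₁.i ≫ j) := by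
    rw [← h₂.fac]
    infer_instance
  have : WeakEquivalence h₁.i := weakEquivalence_of_postcomp h₁.i j
  have : WeakEquivalence (w ≫ f) := by
    rw [← h₁.fac]
    infer_instance
  exact weakEquivalence_of_precomp w f

end

section

variable {C D HC HD : Type*} [Category* C] [Category* D] [ModelCategory C] [ModelCategory D]
  [Category* HC] [Category* HD]
  (LC : C ⥤ HC) [LC.IsLocalization (weakEquivalences C)]
  (LD : D ⥤ HD) [LD.IsLocalization (weakEquivalences D)]
  {F : C ⥤ D} {G : D ⥤ C} (adj : F ⊣ G)

/-- If `F` preserves weak equivalences between cofibrant objects and its right adjoint `G`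
preserves weak equivalences between fibrant objects, their derived functors are adjoint, and
they are compatible with the adjunction `F ⊣ G`. -/
lemma exists_derivedAdjunction
    (hF : ∀ ⦃X Y : C⦄ (f : X ⟶ Y), IsCofibrant X → IsCofibrant Y → WeakEquivalence f →
      WeakEquivalence (F.map f))
    (hG : ∀ ⦃X Y : D⦄ (f : X ⟶ Y), IsFibrant X → IsFibrant Y → WeakEquivalence f →
      WeakEquivalence (G.map f)) :
    ∃ (LF : HC ⥤ HD) (RG : HD ⥤ HC) (α : LC ⋙ LF ⟶ F ⋙ LD) (β : G ⋙ LC ⟶ LD ⋙ RG)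
      (adj' : LF ⊣ RG),
      (∀ X, IsCofibrant X → IsIso (α.app X)) ∧ (∀ Y, IsFibrant Y → IsIso (β.app Y)) ∧
      ∀ {X : C} {Y : D} (f : X ⟶ G.obj Y),
        adj'.homEquiv _ _ (α.app X ≫ LD.map ((adj.homEquiv X Y).symm f)) =
          LC.map f ≫ β.app Y := by
  let Φ := CofibrantObject.localizerMorphism C
  let Ψ := FibrantObject.localizerMorphism D
  have hF' : Φ.Derives (F ⋙ LD) := fun X Y f hf ↦
    Localization.inverts LD (weakEquivalences D) _
      ((weakEquivalence_iff _).1 (hF f.hom X.2 Y.2 ((weakEquivalence_iff _).2 hf)))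
  have hG' : Ψ.Derives (G ⋙ LC) := fun X Y f hf ↦
    Localization.inverts LC (weakEquivalences C) _
      ((weakEquivalence_iff _).1 (hG f.hom X.2 Y.2 ((weakEquivalence_iff _).2 hf)))
  obtain ⟨LF, α, hα⟩ := Φ.exists_leftDerived_of_derives LC (F ⋙ LD) hF'
  have := hG'.hasPointwiseRightDerivedFunctor
  let RG := (G ⋙ LC).totalRightDerived LD (weakEquivalences D)
  let β : G ⋙ LC ⟶ LD ⋙ RG := (G ⋙ LC).totalRightDerivedUnit LD (weakEquivalences D)
  have hβ : ∀ Y, IsIso (β.app (Ψ.functor.obj Y)) := fun Y ↦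
    hG'.isIso_of_isRightDerivedFunctor β Y
  have : LF.IsLeftDerivedFunctor α (weakEquivalences C) := Φ.isLeftDerivedFunctor_of_isIso α hα
  have : (LF ⋙ RG).IsLeftDerivedFunctor
      ((Functor.associator _ _ _).inv ≫ Functor.whiskerRight α RG) (weakEquivalences C) :=
    Φ.isLeftDerivedFunctor_of_isIso _ fun X ↦ by
      have := hα X
      simp only [NatTrans.comp_app, Functor.whiskerRight_app]
      infer_instance
  have hGLF : Ψ.Derives ((G ⋙ LC) ⋙ LF) := fun _ _ f hf ↦ by
    have := hG' f hf
    exact inferInstanceAs (IsIso (LF.map ((Ψ.functor ⋙ G ⋙ LC).map f)))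
  have : (RG ⋙ LF).IsRightDerivedFunctor
      (Functor.whiskerRight β LF ≫ (Functor.associator _ _ _).hom) (weakEquivalences D) :=
    hGLF.isRightDerivedFunctor_of_isIso _ fun Y ↦ by
      have := hβ Y
      simp only [NatTrans.comp_app, Functor.whiskerRight_app]
      infer_instance
  refine ⟨LF, RG, α, β, adj.derived (weakEquivalences C) (weakEquivalences D) α β,
    fun X hX ↦ hα ⟨X, hX⟩, fun Y hY ↦ hβ ⟨Y, hY⟩, fun {X Y} f ↦ ?_⟩
  have h₁ := adj.derivedη_fac_app (weakEquivalences C) α β X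
  have h₂ := β.naturality ((adj.homEquiv X Y).symm f)
  dsimp at h₂
  have h₃ : adj.unit.app X ≫ G.map ((adj.homEquiv X Y).symm f) = f :=
    (adj.homEquiv_unit _ _ _).symm.trans (Equiv.apply_symm_apply _ _)
  rw [Adjunction.homEquiv_unit, Functor.map_comp, Adjunction.derived_unit, reassoc_of% h₁, ← h₂,
    ← LC.map_comp_assoc, h₃]

variable {LC LD} {adj} in
/-- A derived adjunction is an equivalence iff the adjunction is a Quillen equivalence. -/
lemma isEquivalence_iff_of_derivedAdjunction {LF : HC ⥤ HD} {RG : HD ⥤ HC}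
    {α : LC ⋙ LF ⟶ F ⋙ LD} {β : G ⋙ LC ⟶ LD ⋙ RG} (adj' : LF ⊣ RG)
    (hα : ∀ X, IsCofibrant X → IsIso (α.app X)) (hβ : ∀ Y, IsFibrant Y → IsIso (β.app Y))
    (h : ∀ {X : C} {Y : D} (f : X ⟶ G.obj Y),
      adj'.homEquiv _ _ (α.app X ≫ LD.map ((adj.homEquiv X Y).symm f)) = LC.map f ≫ β.app Y) :
    LF.IsEquivalence ↔ ∀ ⦃X : C⦄ ⦃Y : D⦄ (f : X ⟶ G.obj Y), IsCofibrant X → IsFibrant Y →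
      (WeakEquivalence f ↔ WeakEquivalence ((adj.homEquiv X Y).symm f)) := by
  refine ⟨fun _ X Y f hX hY ↦ ?_, fun H ↦ ?_⟩
  · have := hα X hX
    have := hβ Y hY
    rw [← isIso_map_iff_weakEquivalence LC, ← isIso_map_iff_weakEquivalence LD,
      ← isIso_comp_right_iff _ (β.app Y), ← h, adj'.isIso_homEquiv_iff, isIso_comp_left_iff]
  · have hη : IsIso adj'.unit := by
      rw [(CofibrantObject.localizerMorphism C).isIso_iff_of_hasLeftResolutions LC]
      rintro ⟨X, hX⟩
      let j := FibrantObject.HoCat.iResolutionObj (F.obj X)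
      have := hα X hX
      have := hβ (FibrantObject.HoCat.resolutionObj (F.obj X)) inferInstance
      have : IsIso (LD.map j) := (isIso_map_iff_weakEquivalence LD j).2 inferInstance
      have : WeakEquivalence (adj.homEquiv _ _ j) := by
        rw [H _ hX inferInstance, Equiv.symm_apply_apply]
        infer_instance
      have : IsIso (LC.map (adj.homEquiv _ _ j)) := (isIso_map_iff_weakEquivalence LC _).2 this
      have e := h (adj.homEquiv _ _ j)
      rw [Equiv.symm_apply_apply, adj'.homEquiv_unit] at e
      have : IsIso (adj'.unit.app (LC.obj X) ≫ RG.map (α.app X ≫ LD.map j)) := by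
        rw [e]
        infer_instance
      have : IsIso (α.app X ≫ LD.map j) := IsIso.comp_isIso' ‹_› ‹_›
      change IsIso (adj'.unit.app (LC.obj X))
      exact IsIso.of_isIso_comp_right _ (RG.map (α.app X ≫ LD.map j))
    have hε : IsIso adj'.counit := by
      rw [(FibrantObject.localizerMorphism D).isIso_iff_of_hasRightResolutions LD]
      rintro ⟨Y, hY⟩
      let p := CofibrantObject.HoCat.pResolutionObj (G.obj Y)
      have := hα (CofibrantObject.HoCat.resolutionObj (G.obj Y)) inferInstance
      have := hβ Y hY
      have : IsIso (LC.map p) := (isIso_map_iff_weakEquivalence LC p).2 inferInstance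
      have : WeakEquivalence ((adj.homEquiv _ _).symm p) := by
        rw [← H _ inferInstance hY]
        infer_instance
      have : IsIso (LD.map ((adj.homEquiv _ _).symm p)) :=
        (isIso_map_iff_weakEquivalence LD _).2 this
      have e := (Equiv.eq_symm_apply _).2 (h p)
      rw [adj'.homEquiv_counit] at e
      have : IsIso (LF.map (LC.map p ≫ β.app Y) ≫ adj'.counit.app (LD.obj Y)) := by
        rw [← e]
        infer_instance
      have : IsIso (LC.map p ≫ β.app Y) := IsIso.comp_isIso' ‹_› ‹_›
      change IsIso (adj'.counit.app (LD.obj Y))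
      exact IsIso.of_isIso_comp_left (LF.map (LC.map p ≫ β.app Y)) _
    exact adj'.toEquivalence.isEquivalence_functor

end

end HomotopicalAlgebra

/-- The model category attached to a model structure on a category. -/
@[reducible]
def ModelStruct.modelCategory {C : Type u} [Category.{v} C] (S : ModelStruct C) :
    HomotopicalAlgebra.ModelCategory C :=
  have retract {X Y Z W : C} {f : X ⟶ Y} {g : Z ⟶ W} (h : RetractArrow f g) :
      IsRetractOfHom f g :=
    ⟨h.i.left, h.r.left, h.i.right, h.r.right, h.retract_left, h.retract_right, h.i.w, h.r.w.symm⟩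
  have := S.isModel.hasLimits
  have := S.isModel.hasColimits
  { categoryWithFibrations := ⟨S.fib⟩
    categoryWithCofibrations := ⟨S.cof⟩
    categoryWithWeakEquivalences := ⟨S.weq⟩
    cm2 :=
      { comp_mem := S.isModel.weq_comp
        of_postcomp := S.isModel.weq_of_comp_right
        of_precomp := S.isModel.weq_of_comp_left }
    cm3a := ⟨fun h hg ↦ S.isModel.weq_retract _ _ (retract h) hg⟩
    cm3b := ⟨fun h hg ↦ S.isModel.fib_retract _ _ (retract h) hg⟩
    cm3c := ⟨fun h hg ↦ S.isModel.cof_retract _ _ (retract h) hg⟩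
    cm4a := fun i p hi hw hp ↦ S.isModel.lift_acyclicCof_fib i p hi.mem hw.mem hp.mem
    cm4b := fun i p hi hp hw ↦ S.isModel.lift_cof_acyclicFib i p hi.mem hp.mem hw.mem
    cm5a := ⟨fun f ↦
      have ⟨Z, i, p, hi, hw, hp, fac⟩ := S.isModel.factor_acyclicCof_fib f
      ⟨⟨Z, i, p, fac, ⟨hi, hw⟩, hp⟩⟩⟩
    cm5b := ⟨fun f ↦
      have ⟨Z, i, p, hi, hp, hw, fac⟩ := S.isModel.factor_cof_acyclicFib f
      ⟨⟨Z, i, p, fac, hi, ⟨hp, hw⟩⟩⟩⟩ }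

/-- A Quillen functor `F : C ⇄ D : G` induces total derived functors forming
an adjoint pair `LF : Ho(C) ⇄ Ho(D) : RG` between the localizations at the weak
equivalences (with `LF` computed by applying `F` to cofibrant replacements and `RG` by
applying `G` to fibrant replacements), and this adjunction is an equivalence of categories
if and only if `(F, G)` is a Quillen equivalence. -/
theorem statement8 {C : Type u} [Category.{v} C] {D : Type u₂} [Category.{v₂} D]
    [HasLimits C] [HasColimits C] [HasLimits D] [HasColimits D]
    (SC : ModelStruct C) (SD : ModelStruct D)
    (F : C ⥤ D) (G : D ⥤ C) (adj : F ⊣ G)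
    (hFcof : ∀ {X Y : C} (f : X ⟶ Y), SC.cof f → SD.cof (F.map f))
    (hFweq : ∀ {X Y : C} (f : X ⟶ Y), SC.cof (initial.to X) → SC.cof (initial.to Y) →
      SC.weq f → SD.weq (F.map f))
    (hGfib : ∀ {X Y : D} (f : X ⟶ Y), SD.fib f → SC.fib (G.map f))
    (hGweq : ∀ {X Y : D} (f : X ⟶ Y), SD.fib (terminal.from X) →
      SD.fib (terminal.from Y) → SD.weq f → SC.weq (G.map f)) :
    ∃ (LF : SC.weq.Localization ⥤ SD.weq.Localization)
      (RG : SD.weq.Localization ⥤ SC.weq.Localization)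
      (_ : LF ⊣ RG),
      (∀ (X Xc : C) (w : Xc ⟶ X), SC.cof (initial.to Xc) → SC.weq w →
        Nonempty (LF.obj (SC.weq.Q.obj X) ≅ SD.weq.Q.obj (F.obj Xc))) ∧
      (∀ (Y Yf : D) (w : Y ⟶ Yf), SD.fib (terminal.from Yf) → SD.weq w →
        Nonempty (RG.obj (SD.weq.Q.obj Y) ≅ SC.weq.Q.obj (G.obj Yf))) ∧
      (LF.IsEquivalence ↔
        ∀ {X : C} {Y : D} (f : X ⟶ G.obj Y), SC.cof (initial.to X) →
          SD.fib (terminal.from Y) →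
          (SC.weq f ↔ SD.weq ((adj.homEquiv X Y).symm f))) := by
  open HomotopicalAlgebra in
  let _ := SC.modelCategory
  let _ := SD.modelCategory
  let LC : C ⥤ SC.weq.Localization := SC.weq.Q
  let LD : D ⥤ SD.weq.Localization := SD.weq.Q
  have : LC.IsLocalization (weakEquivalences C) :=
    inferInstanceAs (SC.weq.Q.IsLocalization SC.weq)
  have : LD.IsLocalization (weakEquivalences D) :=
    inferInstanceAs (SD.weq.Q.IsLocalization SD.weq)
  obtain ⟨LF, RG, α, β, adj', hα, hβ, h⟩ := exists_derivedAdjunction LC LD adj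
    (fun _ _ f hX hY hf ↦ ⟨hFweq f hX.mem hY.mem hf.mem⟩)
    (fun _ _ f hX hY hf ↦ ⟨hGweq f hX.mem hY.mem hf.mem⟩)
  refine ⟨LF, RG, adj', fun X Xc w hXc hw ↦ ?_, fun Y Yf w hYf hw ↦ ?_, ?_⟩
  · have := hα Xc ⟨hXc⟩
    have := Localization.inverts LC SC.weq w hw
    exact ⟨(LF.mapIso (asIso (LC.map w))).symm ≪≫ asIso (α.app Xc)⟩
  · have := hβ Yf ⟨hYf⟩
    have := Localization.inverts LD SD.weq w hw
    exact ⟨RG.mapIso (asIso (LD.map w)) ≪≫ (asIso (β.app Yf)).symm⟩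
  · rw [isEquivalence_iff_of_derivedAdjunction adj' hα hβ h]
    simp only [weakEquivalence_iff, cofibration_iff, fibration_iff]
    rfl
end

section
/- Let C be a cofibrantly generated model category and F : C ⇄ D : G an adjoint pair with D closed under all small limits and colimits and G commuting with sequential colimits; define a morphism f in D to be a weak equivalence (respectively a fibration) if Gf is one in C. Suppose that (1) there is a functorial fibrant replacement in D: a functor assigning to each object X a weak equivalence X → RX with the map RX → * to the terminal object a fibration; and (2) every object B of D has a natural path object: a natural factorization of the diagonal B → P(B) → B × B where B → P(B) is a weak equivalence and P(B) → B × B is a fibration. Then every morphism in D having the left lifting property with respect to all fibrations is a weak equivalence. -/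
open CategoryTheory CategoryTheory.Limits

universe v u

/-- An object `A` is small with respect to a class `F` of morphisms if for every sequence
`X₀ → X₁ → X₂ → ⋯` of morphisms in `F`, the natural map
`colimₙ Hom(A, Xₙ) → Hom(A, colimₙ Xₙ)` is a bijection. -/
def IsSmallWrt {C : Type u} [Category.{v} C] (A : C) (F : MorphismProperty C) : Prop :=
  ∀ (X : ℕ ⥤ C), (∀ n : ℕ, F (X.map (homOfLE (Nat.le_succ n)))) →
    ∀ (c : Cocone X), IsColimit c →
      (∀ g : A ⟶ c.pt, ∃ (n : ℕ) (h : A ⟶ X.obj n), h ≫ c.ι.app n = g) ∧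
      (∀ (n m : ℕ) (h₁ : A ⟶ X.obj n) (h₂ : A ⟶ X.obj m),
        h₁ ≫ c.ι.app n = h₂ ≫ c.ι.app m →
        ∃ (k : ℕ) (l₁ : n ⟶ k) (l₂ : m ⟶ k), h₁ ≫ X.map l₁ = h₂ ≫ X.map l₂)

/-- The classes `weq`, `fib`, `cof` are cofibrantly generated by the sets of morphisms `I`
and `J`: sources of `I` are small for the cofibrations and the acyclic fibrations are
exactly the maps with the right lifting property against `I`; sources of `J` are small for
the acyclic cofibrations and the fibrations are exactly the maps with the right lifting
property against `J`. -/
def CofGenBy {C : Type u} [Category.{v} C] (weq fib cof : MorphismProperty C)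
    (I J : Set (Arrow C)) : Prop :=
  (∀ i ∈ I, IsSmallWrt i.left cof) ∧
  (∀ {X Y : C} (q : X ⟶ Y), (fib q ∧ weq q) ↔ ∀ i ∈ I, HasLiftingProperty i.hom q) ∧
  (∀ j ∈ J, IsSmallWrt j.left (fun _ _ f => cof f ∧ weq f)) ∧
  (∀ {X Y : C} (q : X ⟶ Y), fib q ↔ ∀ j ∈ J, HasLiftingProperty j.hom q)

/-- A functorial factorization of every morphism into a map in `left` followed by a map in
`right`. -/
def HasFunctorialFactorization {C : Type u} [Category.{v} C]
    (left right : MorphismProperty C) : Prop :=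
  ∃ (Z : Arrow C ⥤ C) (η : Arrow.leftFunc ⟶ Z) (ε : Z ⟶ Arrow.rightFunc),
    ∀ f : Arrow C, left (η.app f) ∧ right (ε.app f) ∧ η.app f ≫ ε.app f = f.hom

universe v₂ u₂

/-- The functor `X ↦ X ⨯ X`. -/
noncomputable def prodSelf (D : Type u₂) [Category.{v₂} D] [HasBinaryProducts D] :
    D ⥤ D where
  obj X := X ⨯ X
  map f := Limits.prod.map f f
  map_id := by intro X; simp
  map_comp := by intros; simp

theorem weq_id {C : Type u} [Category.{v} C] (S : ModelStruct C) (X : C) :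
    S.weq (𝟙 X) := by
  obtain ⟨Z, i, p, -, -, hp, -⟩ := S.isModel.factor_cof_acyclicFib (𝟙 X)
  exact S.isModel.weq_of_comp_left p _ hp (by simpa using hp)

/-- If acyclic fibrations are detected by right lifting, they are stable under base change. -/
theorem acyclicFib_of_isPullback {C : Type u} [Category.{v} C] (S : ModelStruct C)
    {I J : Set (Arrow C)} (hcg : CofGenBy S.weq S.fib S.cof I J)
    {W X Y Z : C} {fst : W ⟶ X} {snd : W ⟶ Y} {f : X ⟶ Z} {g : Y ⟶ Z}
    (h : IsPullback fst snd f g) (hg : S.fib g) (hg' : S.weq g) :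
    S.fib fst ∧ S.weq fst :=
  (hcg.2.1 fst).2 fun i hi =>
    have := (hcg.2.1 g).1 ⟨hg, hg'⟩ i hi
    h.flip.hasLiftingProperty i.hom

/-- A split monomorphism `s` is a weak equivalence as soon as some `m ≫ s` is one. -/
theorem weq_of_comp_of_retraction {C : Type u} [Category.{v} C] (S : ModelStruct C)
    {X Y Z : C} (m : X ⟶ Y) (s : Y ⟶ Z) (w : Z ⟶ Y) (hsw : s ≫ w = 𝟙 Y)
    (hms : S.weq (m ≫ s)) : S.weq s := by
  have hws : S.weq (w ≫ s) :=
    S.isModel.weq_of_comp_left (m ≫ s) _ hms (by simpa [reassoc_of% hsw] using hms)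
  exact S.isModel.weq_retract s (w ≫ s)
    ⟨s, w, 𝟙 Z, 𝟙 Z, hsw, by simp, by simp [reassoc_of% hsw], by simp⟩ hws

/-- The two-out-of-six property, when the last morphism is a fibration. -/
theorem weq_of_twoOutOfSix_of_fib {C : Type u} [Category.{v} C] (S : ModelStruct C)
    {I J : Set (Arrow C)} (hcg : CofGenBy S.weq S.fib S.cof I J)
    {X Y Z W : C} (f : X ⟶ Y) (g : Y ⟶ Z) (h : Z ⟶ W) (hh : S.fib h)
    (hfg : S.weq (f ≫ g)) (hgh : S.weq (g ≫ h)) : S.weq g := by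
  have := S.isModel.hasLimits
  obtain ⟨V, j, q, hj, hj', hq, fac⟩ := S.isModel.factor_acyclicCof_fib (g ≫ h)
  have hq' : S.weq q := S.isModel.weq_of_comp_left j q hj' (by rwa [fac])
  have := S.isModel.lift_acyclicCof_fib j h hj hj' hh
  have sq : CommSq g j h q := ⟨fac.symm⟩
  have ha := acyclicFib_of_isPullback S hcg (IsPullback.of_hasPullback h q) hq hq'
  let s : V ⟶ pullback h q := pullback.lift sq.lift (𝟙 V) (by simp)
  have hs : j ≫ s ≫ pullback.fst h q = g := by
    rw [pullback.lift_fst, sq.fac_left]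
  have hs' : S.weq s := by
    refine weq_of_comp_of_retraction S (f ≫ j) s (pullback.snd h q) (pullback.lift_snd _ _ _) ?_
    refine S.isModel.weq_of_comp_right _ (pullback.fst h q) ha.2 ?_
    rwa [Category.assoc, Category.assoc, hs]
  rw [← hs]
  exact S.isModel.weq_comp _ _ hj' (S.isModel.weq_comp _ _ hs' ha.2)

/-- The two-out-of-six property. -/
theorem weq_of_twoOutOfSix {C : Type u} [Category.{v} C] (S : ModelStruct C)
    {I J : Set (Arrow C)} (hcg : CofGenBy S.weq S.fib S.cof I J)
    {X Y Z W : C} (f : X ⟶ Y) (g : Y ⟶ Z) (h : Z ⟶ W)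
    (hfg : S.weq (f ≫ g)) (hgh : S.weq (g ≫ h)) : S.weq g := by
  obtain ⟨Z', c, p, -, hc, hp, rfl⟩ := S.isModel.factor_acyclicCof_fib h
  refine S.isModel.weq_of_comp_right g c hc
    (weq_of_twoOutOfSix_of_fib S hcg f (g ≫ c) p hp ?_ (by simpa using hgh))
  simpa using S.isModel.weq_comp _ _ hfg hc

/-- A morphism lifting against fibrations is a weak equivalence as soon as it is related by
weak equivalences to a morphism `f'` between objects the source of which is fibrant and the
target of which has a path object. -/
theorem weq_map_of_pathObject {C : Type u} [Category.{v} C] {D : Type u₂} [Category.{v₂} D]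
    [HasTerminal D] [HasBinaryProducts D]
    (S : ModelStruct C) {I J : Set (Arrow C)} (hcg : CofGenBy S.weq S.fib S.cof I J)
    (G : D ⥤ C) {A B A' B' PB : D} (f : A ⟶ B)
    (hf : ∀ {X Y : D} (q : X ⟶ Y), S.fib (G.map q) → HasLiftingProperty f q)
    (a : A ⟶ A') (b : B ⟶ B') (f' : A' ⟶ B') (comm : f ≫ b = a ≫ f')
    (ha : S.weq (G.map a)) (hb : S.weq (G.map b)) (hA' : S.fib (G.map (terminal.from A')))
    (i : B' ⟶ PB) (q : PB ⟶ B' ⨯ B') (hi : S.weq (G.map i)) (hq : S.fib (G.map q))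
    (fac : i ≫ q = prod.lift (𝟙 B') (𝟙 B')) : S.weq (G.map f) := by
  have := hf _ hA'
  have sq : CommSq a f (terminal.from A') (terminal.from B) := ⟨Subsingleton.elim _ _⟩
  obtain ⟨r, hr⟩ : ∃ r, f ≫ r = a := ⟨sq.lift, sq.fac_left⟩
  have := hf _ hq
  have sq' : CommSq (f ≫ b ≫ i) f q (prod.lift b (r ≫ f')) :=
    ⟨by ext <;> simp [fac, reassoc_of% hr, comm]⟩
  obtain ⟨H, hH⟩ : ∃ H, H ≫ q = prod.lift b (r ≫ f') := ⟨sq'.lift, sq'.fac_right⟩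
  have weq_proj (π : B' ⨯ B' ⟶ B') (hπ : prod.lift (𝟙 B') (𝟙 B') ≫ π = 𝟙 B') :
      S.weq (G.map (q ≫ π)) := by
    refine S.isModel.weq_of_comp_left _ _ hi ?_
    rw [← G.map_comp, reassoc_of% fac, hπ, G.map_id]
    exact weq_id S _
  have hH' : S.weq (G.map H) := by
    refine S.isModel.weq_of_comp_right _ _ (weq_proj prod.fst (prod.lift_fst _ _)) ?_
    rwa [← G.map_comp, reassoc_of% hH, prod.lift_fst]
  have hrf : S.weq (G.map r ≫ G.map f') := by
    have := S.isModel.weq_comp _ _ hH' (weq_proj prod.snd (prod.lift_snd _ _))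
    rwa [← G.map_comp, reassoc_of% hH, prod.lift_snd, G.map_comp] at this
  have hfr : S.weq (G.map f ≫ G.map r) := by rwa [← G.map_comp, hr]
  exact S.isModel.weq_of_comp_right _ _ (weq_of_twoOutOfSix S hcg _ _ _ hfr hrf) hfr

/-- Quillen's path object criterion: let `C` be a cofibrantly generated
model category and `F : C ⇄ D : G` an adjoint pair with `D` bicomplete and `G` commuting
with sequential colimits; define weak equivalences and fibrations of `D` via `G`.  If `D`
has a functorial fibrant replacement and a natural path object, then every morphism of `D`
with the left lifting property against all fibrations is a weak equivalence. -/
theorem statement11 {C : Type u} [Category.{v} C] {D : Type u₂} [Category.{v₂} D]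
    [HasLimits D] [HasColimits D]
    (S : ModelStruct C) (I J : Set (Arrow C)) (hcg : CofGenBy S.weq S.fib S.cof I J)
    (F : C ⥤ D) (G : D ⥤ C) (adj : F ⊣ G)
    (hG_colim : ∀ (X : ℕ ⥤ D) (c : Cocone X), IsColimit c → IsColimit (G.mapCocone c))
    (R : D ⥤ D) (η : 𝟭 D ⟶ R)
    (hR : ∀ X : D, S.weq (G.map (η.app X)) ∧ S.fib (G.map (terminal.from (R.obj X))))
    (P : D ⥤ D) (ip : 𝟭 D ⟶ P) (qp : P ⟶ prodSelf D)
    (hP : ∀ X : D, S.weq (G.map (ip.app X)) ∧ S.fib (G.map (qp.app X)) ∧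
      ip.app X ≫ qp.app X = prod.lift (𝟙 X) (𝟙 X)) :
    ∀ {A B : D} (f : A ⟶ B),
      (∀ {X Y : D} (q : X ⟶ Y), S.fib (G.map q) → HasLiftingProperty f q) →
      S.weq (G.map f) := by
  intro A B f hf
  obtain ⟨hi, hq, fac⟩ := hP (R.obj B)
  exact weq_map_of_pathObject S hcg G f hf (η.app A) (η.app B) (R.map f) (η.naturality f)
    (hR A).1 (hR B).1 (hR A).2 (ip.app (R.obj B)) (qp.app (R.obj B)) hi hq fac
end
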